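/- arXiv:1608.04061 — 2 statements merged into one kernel-verified Lean document; each statement's English description precedes it below -/
import Mathlib

section
/- Let n ≥ 5 be an integer, b > 0, and let V : (0,∞) → ℝ satisfy V(t) ≥ 0 for all t > 0 and t ↦ V(t)/tⁿ non-increasing on (0,∞). If ∫₀^∞ (V(t) - b ωₙ tⁿ) · ((n-1)λ + t²) t (λ + t²)^{-n} dt ≥ 0 for every λ > 0, then V(r) ≥ b ωₙ rⁿ for every r > 0. -/
open MeasureTheory

theorem aux_neg (n : ℕ) (hn : 5 ≤ n) (f : ℝ → ℝ) (r δ : ℝ) (hr : 0 < r) (hδ : 0 < δ)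
    (hf : ∀ t, r ≤ t → f t ≤ -(δ * t ^ n))
    (hi : ∀ lam > (0 : ℝ), IntegrableOn
      (fun t : ℝ => f t * ((((n : ℝ) - 1) * lam + t ^ 2) * t * (lam + t ^ 2) ^ (-(n : ℝ))))
      (Set.Ioi 0))
    (hint : ∀ lam > (0 : ℝ), 0 ≤ ∫ t in Set.Ioi (0 : ℝ),
      f t * ((((n : ℝ) - 1) * lam + t ^ 2) * t * (lam + t ^ 2) ^ (-(n : ℝ)))) : False := by
  have hn1 : (5 : ℝ) ≤ n := by exact_mod_cast hn
  have hK : ∀ lam > (0 : ℝ), ∀ t > (0 : ℝ),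
      0 < (((n : ℝ) - 1) * lam + t ^ 2) * t * (lam + t ^ 2) ^ (-(n : ℝ)) := by
    intro lam hl t ht
    have : 0 < (n : ℝ) - 1 := by linarith
    positivity
  have hpw : ∀ x > (0 : ℝ), x ^ (-(n : ℝ)) = (x ^ n)⁻¹ := by
    intro x hx
    rw [Real.rpow_neg hx.le, Real.rpow_natCast]
  set A : ℝ := (1 + r ^ 2) ^ n with hA
  have hA0 : 0 < A := by positivity
  set M : ℝ := ∫ t in Set.Ioi (0 : ℝ),
    |f t * ((((n : ℝ) - 1) * 1 + t ^ 2) * t * (1 + t ^ 2) ^ (-(n : ℝ)))| with hM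
  have hM0 : 0 ≤ M := integral_nonneg fun t => abs_nonneg _
  have key : ∀ s : ℝ, 1 ≤ s → r ≤ s → δ / 5 ^ n * s ^ (n + 2) ≤ A * M := by
    intro s hs1 hsr
    have hs0 : 0 < s := by linarith
    have hl0 : 0 < s ^ 2 := by positivity
    have hl1 : 1 ≤ s ^ 2 := one_le_pow₀ hs1
    set B : ℝ := s ^ 2 * ((s ^ 2) ^ n)⁻¹ * A with hB
    have hB0 : 0 < B := by positivity
    set e : ℝ := δ * s ^ n * (s ^ 2 * s * ((5 * s ^ 2) ^ n)⁻¹) with he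
    have hle : ∀ t ∈ Set.Ioi (0 : ℝ),
        f t * ((((n : ℝ) - 1) * s ^ 2 + t ^ 2) * t * (s ^ 2 + t ^ 2) ^ (-(n : ℝ))) ≤
        B * |f t * ((((n : ℝ) - 1) * 1 + t ^ 2) * t * (1 + t ^ 2) ^ (-(n : ℝ)))|
          - (Set.Icc s (2 * s)).indicator (fun _ => e) t := by
      intro t ht
      have ht0 : 0 < t := ht
      have hk := hK (s ^ 2) hl0 t ht0
      by_cases htr : r ≤ t
      · have h1 := hf t htr
        have hpos : 0 ≤ B * |f t * ((((n : ℝ) - 1) * 1 + t ^ 2) * t * (1 + t ^ 2) ^ (-(n : ℝ)))| := by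
          positivity
        by_cases hts : t ∈ Set.Icc s (2 * s)
        · rw [Set.indicator_of_mem hts]
          obtain ⟨h2, h3⟩ := hts
          have h4 : s ^ 2 * s * ((5 * s ^ 2) ^ n)⁻¹ ≤
              (((n : ℝ) - 1) * s ^ 2 + t ^ 2) * t * (s ^ 2 + t ^ 2) ^ (-(n : ℝ)) := by
            rw [hpw _ (by positivity)]
            have h5 : s ^ 2 + t ^ 2 ≤ 5 * s ^ 2 := by nlinarith
            have h6 : s ^ 2 ≤ ((n : ℝ) - 1) * s ^ 2 + t ^ 2 := by nlinarith [sq_nonneg t]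
            have h60 : 0 ≤ ((n : ℝ) - 1) * s ^ 2 + t ^ 2 := hl0.le.trans h6
            have h61 : 0 ≤ (((n : ℝ) - 1) * s ^ 2 + t ^ 2) * t := mul_nonneg h60 ht0.le
            gcongr
          have h7 : e ≤ δ * t ^ n *
              ((((n : ℝ) - 1) * s ^ 2 + t ^ 2) * t * (s ^ 2 + t ^ 2) ^ (-(n : ℝ))) := by
            rw [he]; gcongr
          have h8 := mul_le_mul_of_nonneg_right h1 hk.le
          linarith
        · rw [Set.indicator_of_notMem hts]
          have h9 : f t ≤ 0 := h1.trans (by have : 0 < δ * t ^ n := by positivity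
                                            linarith)
          have := mul_nonpos_of_nonpos_of_nonneg h9 hk.le
          linarith
      · push Not at htr
        rw [Set.indicator_of_notMem (fun h => by have := h.1; linarith)]
        have hk1 := hK 1 one_pos t ht0
        rw [abs_mul, abs_of_pos hk1, sub_zero]
        have h4 : (((n : ℝ) - 1) * s ^ 2 + t ^ 2) * t * (s ^ 2 + t ^ 2) ^ (-(n : ℝ)) ≤
            B * ((((n : ℝ) - 1) * 1 + t ^ 2) * t * (1 + t ^ 2) ^ (-(n : ℝ))) := by
          rw [hpw _ (by positivity), hpw _ (by positivity)]
          have h5 : ((n : ℝ) - 1) * s ^ 2 + t ^ 2 ≤ s ^ 2 * (((n : ℝ) - 1) * 1 + t ^ 2) := by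
            nlinarith [sq_nonneg t]
          have h6 : ((s ^ 2 + t ^ 2) ^ n)⁻¹ ≤ ((s ^ 2) ^ n)⁻¹ := by
            gcongr
            linarith [sq_nonneg t]
          have h7 : 1 ≤ A * ((1 + t ^ 2) ^ n)⁻¹ := by
            rw [← div_eq_mul_inv, one_le_div (by positivity), hA]
            gcongr
          have h50 : 0 ≤ ((n : ℝ) - 1) * 1 + t ^ 2 := by nlinarith [sq_nonneg t]
          calc _ ≤ (s ^ 2 * (((n : ℝ) - 1) * 1 + t ^ 2)) * t * ((s ^ 2) ^ n)⁻¹ := by gcongr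
            _ ≤ (s ^ 2 * (((n : ℝ) - 1) * 1 + t ^ 2)) * t * ((s ^ 2) ^ n)⁻¹ *
                (A * ((1 + t ^ 2) ^ n)⁻¹) := le_mul_of_one_le_right (by positivity) h7
            _ = _ := by rw [hB]; ring
        calc _ ≤ |f t| * ((((n : ℝ) - 1) * s ^ 2 + t ^ 2) * t * (s ^ 2 + t ^ 2) ^ (-(n : ℝ))) :=
              mul_le_mul_of_nonneg_right (le_abs_self _) hk.le
          _ ≤ |f t| * (B * ((((n : ℝ) - 1) * 1 + t ^ 2) * t * (1 + t ^ 2) ^ (-(n : ℝ)))) :=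
              mul_le_mul_of_nonneg_left h4 (abs_nonneg _)
          _ = _ := by ring
    have hi1 : IntegrableOn (fun t : ℝ => B *
        |f t * ((((n : ℝ) - 1) * 1 + t ^ 2) * t * (1 + t ^ 2) ^ (-(n : ℝ)))|) (Set.Ioi 0) :=
      ((hi 1 one_pos).abs).const_mul B
    have hi2 : IntegrableOn ((Set.Icc s (2 * s)).indicator (fun _ => e)) (Set.Ioi 0) := by
      apply Integrable.integrableOn
      rw [integrable_indicator_iff measurableSet_Icc]
      exact integrableOn_const (by simp)
    have h1 := setIntegral_mono_on (hi _ hl0) (hi1.sub hi2) measurableSet_Ioi hle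
    have h2 := (hint _ hl0).trans h1
    have h3 : ∫ t in Set.Ioi (0 : ℝ), (Set.Icc s (2 * s)).indicator (fun _ => e) t = s * e := by
      have hsub : Set.Icc s (2 * s) ⊆ Set.Ioi 0 := fun x hx => lt_of_lt_of_le hs0 hx.1
      rw [setIntegral_indicator measurableSet_Icc, Set.inter_eq_self_of_subset_right hsub]
      rw [setIntegral_const]
      simp only [Measure.real, Real.volume_Icc, smul_eq_mul]
      rw [ENNReal.toReal_ofReal (by linarith)]
      ring
    simp only [Pi.sub_apply] at h2
    rw [integral_sub hi1 hi2, h3, integral_const_mul, ← hM] at h2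
    have h4 : s * e ≤ B * M := by linarith
    have h5 : s * e = (s ^ 2 * ((s ^ 2) ^ n)⁻¹) * (δ / 5 ^ n * s ^ (n + 2)) := by
      rw [he, mul_pow, mul_inv]; ring
    have h6 : B * M = (s ^ 2 * ((s ^ 2) ^ n)⁻¹) * (A * M) := by rw [hB]; ring
    rw [h5, h6] at h4
    exact le_of_mul_le_mul_left h4 (by positivity)
  set d : ℝ := δ / 5 ^ n with hd
  have hd0 : 0 < d := by positivity
  set s : ℝ := 1 + r + A * M / d with hs
  have hq : 0 ≤ A * M / d := by positivity
  have hs1 : 1 ≤ s := by linarith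
  have h1 := key s hs1 (by linarith)
  have h2 : s ≤ s ^ (n + 2) := le_self_pow₀ hs1 (by omega)
  have h3 : d * s ≤ A * M := (mul_le_mul_of_nonneg_left h2 hd0.le).trans h1
  have h4 : d * s = d * (1 + r) + A * M := by rw [hs]; field_simp
  have : 0 < d * (1 + r) := by positivity
  linarith

/-- Global volume non-collapsing (Step 5 of the proof of the main theorem).
Let `n ≥ 5`, `b > 0`, and let `V : (0,∞) → ℝ` be nonnegative with `t ↦ V(t)/tⁿ`
non-increasing on `(0,∞)` (so that, as in the paper, all the integrals below are finite;
we record this as an integrability hypothesis). If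
`∫₀^∞ (V(t) - bωₙtⁿ)((n-1)λ + t²) t (λ+t²)^{-n} dt ≥ 0` for every `λ > 0`, then
`V(r) ≥ bωₙrⁿ` for every `r > 0`, where `ωₙ = π^{n/2}/Γ(n/2+1)`. -/
theorem stmt_14 (n : ℕ) (hn : 5 ≤ n) (b : ℝ) (hb : 0 < b) (V : ℝ → ℝ)
    (hVmeas : Measurable V) (hV0 : ∀ t > (0 : ℝ), 0 ≤ V t)
    (hVmono : AntitoneOn (fun t => V t / t ^ n) (Set.Ioi 0))
    (hVint : ∀ lam > (0 : ℝ), IntegrableOn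
      (fun t : ℝ =>
        (V t - b * (Real.pi ^ ((n : ℝ) / 2) / Real.Gamma ((n : ℝ) / 2 + 1)) * t ^ n) *
          ((((n : ℝ) - 1) * lam + t ^ 2) * t * (lam + t ^ 2) ^ (-(n : ℝ))))
      (Set.Ioi 0))
    (hint : ∀ lam > (0 : ℝ),
      0 ≤ ∫ t in Set.Ioi (0 : ℝ),
        (V t - b * (Real.pi ^ ((n : ℝ) / 2) / Real.Gamma ((n : ℝ) / 2 + 1)) * t ^ n) *
          ((((n : ℝ) - 1) * lam + t ^ 2) * t * (lam + t ^ 2) ^ (-(n : ℝ)))) :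
    ∀ r > (0 : ℝ),
      b * (Real.pi ^ ((n : ℝ) / 2) / Real.Gamma ((n : ℝ) / 2 + 1)) * r ^ n ≤ V r := by
  intro r hr
  by_contra hcon
  push Not at hcon
  set c : ℝ := b * (Real.pi ^ ((n : ℝ) / 2) / Real.Gamma ((n : ℝ) / 2 + 1)) with hc
  have hrn : 0 < r ^ n := by positivity
  refine aux_neg n hn (fun t => V t - c * t ^ n) r (c - V r / r ^ n) hr ?_ ?_ hVint hint
  · rw [sub_pos, div_lt_iff₀ hrn]; exact hcon
  · intro t ht
    have ht0 : 0 < t := lt_of_lt_of_le hr ht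
    have h := hVmono (Set.mem_Ioi.2 hr) (Set.mem_Ioi.2 ht0) ht
    simp only at h
    rw [div_le_iff₀ (by positivity)] at h
    show V t - c * t ^ n ≤ _
    linarith
end

section
/- Let n ≥ 5 be an integer and let V : (0,∞) → ℝ be measurable with 0 ≤ V(t) ≤ ωₙ tⁿ for all t > 0 and lim_{t→0⁺} V(t)/(ωₙ tⁿ) = 1. Define Φ_V(λ) = ∫₀^∞ V(t) · t (nλ + t²) (λ + t²)^{-n} dt and Φ_W(λ) = ∫₀^∞ ωₙ tⁿ · t (nλ + t²) (λ + t²)^{-n} dt for λ > 0. Then liminf_{λ→0⁺} Φ_V(λ)/Φ_W(λ) ≥ 1. -/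
open MeasureTheory Filter

lemma aux_bound (n : ℕ) (hn : 5 ≤ n) (s : ℝ) (hs : 0 < s) :
    s ^ n * (s * (n + s ^ 2) / (1 + s ^ 2) ^ n) ≤ n * (1 + s ^ 2)⁻¹ := by
  obtain ⟨m, rfl⟩ := Nat.exists_eq_add_of_le' hn
  have h1 : (0:ℝ) < 1 + s ^ 2 := by positivity
  have hs1 : s ≤ 1 + s ^ 2 := by nlinarith [sq_nonneg (s - 1)]
  have h2 : s ^ m ≤ (1 + s ^ 2) ^ m := pow_le_pow_left₀ hs.le hs1 m
  have h3 : (s ^ 2) ^ 3 ≤ (1 + s ^ 2) ^ 3 := pow_le_pow_left₀ (by positivity) (by linarith) 3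
  have h4 : ((m + 5 : ℕ) : ℝ) + s ^ 2 ≤ ((m + 5 : ℕ) : ℝ) * (1 + s ^ 2) := by
    have : (1:ℝ) ≤ ((m + 5 : ℕ) : ℝ) := by exact_mod_cast (by omega)
    nlinarith [sq_nonneg s]
  have h5 : s ^ m * (s ^ 2) ^ 3 * (((m + 5 : ℕ) : ℝ) + s ^ 2) ≤
      (1 + s ^ 2) ^ m * (1 + s ^ 2) ^ 3 * (((m + 5 : ℕ) : ℝ) * (1 + s ^ 2)) := by
    gcongr
  rw [← mul_div_assoc, div_le_iff₀ (by positivity)]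
  calc _ = s ^ m * (s ^ 2) ^ 3 * (((m + 5 : ℕ) : ℝ) + s ^ 2) := by ring
    _ ≤ _ := h5
    _ = _ := by rw [pow_add _ m 5]; field_simp

lemma aux_scale (n : ℕ) (U : ℝ → ℝ) (c : ℝ) (hc : 0 < c) (lam : ℝ) (hl : 0 < lam) :
    ∫ t in Set.Ioi (0 : ℝ), U t * (t * ((n : ℝ) * lam + t ^ 2) * (lam + t ^ 2) ^ (-(n : ℝ)))
    = (√lam * (c * √lam ^ n * √lam * lam / lam ^ n)) * ∫ s in Set.Ioi (0 : ℝ),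
      (U (√lam * s) / (c * (√lam * s) ^ n)) *
        (s ^ n * (s * (n + s ^ 2) / (1 + s ^ 2) ^ n)) := by
  have hm : 0 < √lam := Real.sqrt_pos.2 hl
  have h := integral_comp_mul_left_Ioi
    (fun t => U t * (t * ((n : ℝ) * lam + t ^ 2) * (lam + t ^ 2) ^ (-(n : ℝ)))) 0 hm
  rw [mul_zero, smul_eq_mul, eq_inv_mul_iff_mul_eq₀ hm.ne'] at h
  rw [← h, mul_assoc]
  congr 1
  rw [← integral_const_mul]
  apply setIntegral_congr_fun measurableSet_Ioi
  intro s hs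
  have hs : 0 < s := hs
  have h1 : (0:ℝ) < 1 + s ^ 2 := by positivity
  have e : (√lam * s) ^ 2 = lam * s ^ 2 := by rw [mul_pow, Real.sq_sqrt hl.le]
  have e2 : lam + lam * s ^ 2 = lam * (1 + s ^ 2) := by ring
  simp only [e, e2]
  rw [Real.rpow_neg (by positivity), Real.rpow_natCast, mul_pow, mul_pow]
  field_simp

/-- Comparison of `F - λF'` with its Euclidean counterpart near `λ = 0`
(Step 3 of the proof of the main theorem). Let `n ≥ 5` and let `V` be measurable with
`0 ≤ V(t) ≤ ωₙtⁿ` on `(0,∞)` and `V(t)/(ωₙtⁿ) → 1` as `t → 0⁺`. With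
`Φ_V(λ) = ∫₀^∞ V(t) t (nλ+t²)(λ+t²)^{-n} dt` and `Φ_W` the analogous quantity for
`W(t) = ωₙtⁿ`, one has `liminf_{λ→0⁺} Φ_V(λ)/Φ_W(λ) ≥ 1`. -/
theorem stmt_17 (n : ℕ) (hn : 5 ≤ n) (V : ℝ → ℝ) (hVmeas : Measurable V)
    (hV : ∀ t > (0 : ℝ), 0 ≤ V t ∧
      V t ≤ (Real.pi ^ ((n : ℝ) / 2) / Real.Gamma ((n : ℝ) / 2 + 1)) * t ^ n)
    (hlim : Tendsto
      (fun t : ℝ => V t / ((Real.pi ^ ((n : ℝ) / 2) / Real.Gamma ((n : ℝ) / 2 + 1)) * t ^ n))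
      (nhdsWithin 0 (Set.Ioi 0)) (nhds 1)) :
    1 ≤ liminf
      (fun lam : ℝ =>
        (∫ t in Set.Ioi (0 : ℝ),
            V t * (t * ((n : ℝ) * lam + t ^ 2) * (lam + t ^ 2) ^ (-(n : ℝ)))) /
        (∫ t in Set.Ioi (0 : ℝ),
            ((Real.pi ^ ((n : ℝ) / 2) / Real.Gamma ((n : ℝ) / 2 + 1)) * t ^ n) *
              (t * ((n : ℝ) * lam + t ^ 2) * (lam + t ^ 2) ^ (-(n : ℝ)))))
      (nhdsWithin 0 (Set.Ioi 0)) := by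
  have hc : 0 < Real.pi ^ ((n : ℝ) / 2) / Real.Gamma ((n : ℝ) / 2 + 1) :=
    div_pos (Real.rpow_pos_of_pos Real.pi_pos _) (Real.Gamma_pos_of_pos (by positivity))
  generalize Real.pi ^ ((n : ℝ) / 2) / Real.Gamma ((n : ℝ) / 2 + 1) = c at *
  set k : ℝ → ℝ := fun s => s ^ n * (s * (n + s ^ 2) / (1 + s ^ 2) ^ n) with hk
  have hkm : Measurable k := by fun_prop
  have hkpos : ∀ s, 0 < s → 0 < k s := by
    intro s hs
    have : 0 < n := by omega
    simp only [hk]; positivity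
  have hki : IntegrableOn k (Set.Ioi 0) := by
    have hb : IntegrableOn (fun s : ℝ => (n : ℝ) * (1 + s ^ 2)⁻¹) (Set.Ioi 0) :=
      (integrable_inv_one_add_sq.const_mul _).integrableOn
    refine Integrable.mono' hb hkm.aestronglyMeasurable ?_
    filter_upwards [ae_restrict_mem measurableSet_Ioi] with s hs
    rw [Real.norm_of_nonneg (hkpos s hs).le]
    exact aux_bound n hn s hs
  have hI : 0 < ∫ s in Set.Ioi (0:ℝ), k s := by
    rw [setIntegral_pos_iff_support_of_nonneg_ae _ hki]
    · have : Function.support k ∩ Set.Ioi 0 = Set.Ioi 0 :=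
        Set.inter_eq_right.2 fun s hs => (hkpos s hs).ne'
      rw [this]; simp
    · filter_upwards [ae_restrict_mem measurableSet_Ioi] with s hs using (hkpos s hs).le
  have hT : Tendsto (fun lam : ℝ => ∫ s in Set.Ioi (0:ℝ),
      (V (√lam * s) / (c * (√lam * s) ^ n)) * k s) (nhdsWithin 0 (Set.Ioi 0))
      (nhds (∫ s in Set.Ioi (0:ℝ), k s)) := by
    refine tendsto_integral_filter_of_dominated_convergence k ?_ ?_ hki ?_
    · refine Eventually.of_forall fun lam => Measurable.aestronglyMeasurable ?_
      fun_prop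
    · filter_upwards [self_mem_nhdsWithin] with lam hl
      filter_upwards [ae_restrict_mem measurableSet_Ioi] with s hs
      have hl : 0 < lam := hl
      have hs : 0 < s := hs
      have hm : 0 < √lam := Real.sqrt_pos.2 hl
      have hp : 0 < √lam * s := by positivity
      obtain ⟨h1, h2⟩ := hV _ hp
      have hk0 := hkpos s hs
      rw [Real.norm_of_nonneg (by positivity)]
      exact mul_le_of_le_one_left hk0.le ((div_le_one (by positivity)).2 h2)
    · filter_upwards [ae_restrict_mem measurableSet_Ioi] with s hs
      have hs : 0 < s := hs
      have ht : Tendsto (fun lam : ℝ => √lam * s) (nhdsWithin 0 (Set.Ioi 0))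
          (nhdsWithin 0 (Set.Ioi 0)) := by
        refine tendsto_nhdsWithin_iff.2 ⟨?_, ?_⟩
        · have : Continuous (fun lam : ℝ => √lam * s) := by fun_prop
          have h := this.tendsto 0
          simp only [Real.sqrt_zero, zero_mul] at h
          exact h.mono_left nhdsWithin_le_nhds
        · filter_upwards [self_mem_nhdsWithin] with lam hl
          exact mul_pos (Real.sqrt_pos.2 hl) hs
      simpa using (hlim.comp ht).mul_const (k s)
  have hT2 := hT.div_const (∫ s in Set.Ioi (0:ℝ), k s)
  rw [div_self hI.ne'] at hT2
  refine le_of_eq (Tendsto.liminf_eq (hT2.congr' ?_)).symm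
  filter_upwards [self_mem_nhdsWithin] with lam hl
  have hl : 0 < lam := hl
  have hm : 0 < √lam := Real.sqrt_pos.2 hl
  rw [aux_scale n V c hc lam hl, aux_scale n (fun t => c * t ^ n) c hc lam hl,
    mul_div_mul_left _ _ (by positivity)]
  congr 1
  apply setIntegral_congr_fun measurableSet_Ioi
  intro s hs
  have hs : 0 < s := hs
  have : c * (√lam * s) ^ n ≠ 0 := by positivity
  simp only [hk, div_self this, one_mul]
end
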